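/- Let μ be a finite nonnegative Radon measure on a bounded domain Ω ⊆ ℝⁿ and let p ∈ Ω satisfy R^{α,Ω}_μ(p) = ∞ for α ∈ (1, n). Then there exists a set A ⊆ ℝⁿ that is α-thin at p such that lim_{x→p, x∉A} |x-p|^{n-α} R^{α,Ω}_μ(x) = μ({p}). -/

import Mathlib

open MeasureTheory Metric Set Filter
open scoped ENNReal NNReal Topology

noncomputable section

/-- Euclidean n-space. -/
abbrev Euc (n : ℕ) := EuclideanSpace ℝ (Fin n)

/-- The Riesz potential `R^{α,Ω}_μ(x)`: for `α < n` it is `∫_Ω |x-y|^{α-n} dμ(y)`,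
and for `α = n` (the remaining case `α ≤ n`) it is `∫_Ω log (D/|x-y|) dμ(y)`
where `D = diam Ω`. -/
def rieszPotential (n : ℕ) (α : ℝ) (Ω : Set (Euc n)) (μ : Measure (Euc n)) (x : Euc n) :
    ℝ≥0∞ :=
  if α < n then ∫⁻ y in Ω, ENNReal.ofReal (‖x - y‖ ^ (α - (n : ℝ))) ∂μ
  else ∫⁻ y in Ω, ENNReal.ofReal (Real.log (Metric.diam Ω / ‖x - y‖)) ∂μ

/-- The Riesz capacity
`C^α_L(E,Ω) = inf { μ(Ω) : μ ≥ 0 a Radon measure on Ω, R^{α,Ω}_μ ≥ 1 on E }`. -/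
def rieszCap (n : ℕ) (α : ℝ) (E Ω : Set (Euc n)) : ℝ≥0∞ :=
  sInf {c | ∃ μ : Measure (Euc n),
    (∀ x ∈ E, 1 ≤ rieszPotential n α Ω μ x) ∧ c = μ Ω}

/-- The closed dyadic annulus `ω^δ_i(p) = {x : |x-p| ∈ [2^{-i} δ, 2^{-i+1} δ]}`. -/
def dyadicAnnulus (n : ℕ) (δ : ℝ) (i : ℕ) (p : Euc n) : Set (Euc n) :=
  {x | ‖x - p‖ ∈ Set.Icc ((2 : ℝ) ^ (-(i : ℤ)) * δ) ((2 : ℝ) ^ (-(i : ℤ) + 1) * δ)}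

/-- The open dyadic annulus `Ω^δ_i(p) = {x : |x-p| ∈ (2^{-i-1} δ, 2^{-i+2} δ)}`. -/
def dyadicAnnulusO (n : ℕ) (δ : ℝ) (i : ℕ) (p : Euc n) : Set (Euc n) :=
  {x | ‖x - p‖ ∈ Set.Ioo ((2 : ℝ) ^ (-(i : ℤ) - 1) * δ) ((2 : ℝ) ^ (-(i : ℤ) + 2) * δ)}

/-- `E` is `α`-thin at `p` with respect to the Riesz capacity: for `α ∈ (1, n)` this means
`Σ_{i≥1} C^α_L(E ∩ ω^δ_i(p), Ω^δ_i(p)) / C^α_L(∂B_{2^{-i}δ}(p), B_{2^{-i+1}δ}(p)) < ∞`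
for some small `δ > 0`; for `α = n` it means
`Σ_{i≥1} i · C^n_L(E ∩ ω^δ_i(p), Ω^δ_i(p)) < ∞` for some small `δ > 0`. -/
def RieszThinAt (n : ℕ) (α : ℝ) (E : Set (Euc n)) (p : Euc n) : Prop :=
  if α < n then
    ∃ δ > (0 : ℝ), ∑' i : ℕ,
      rieszCap n α (E ∩ dyadicAnnulus n δ (i + 1) p) (dyadicAnnulusO n δ (i + 1) p) /
        rieszCap n α (Metric.sphere p ((2 : ℝ) ^ (-(i : ℤ) - 1) * δ))
          (Metric.ball p ((2 : ℝ) ^ (-(i : ℤ)) * δ)) < ⊤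
  else
    ∃ δ > (0 : ℝ), ∑' i : ℕ,
      ((i + 1 : ℕ) : ℝ≥0∞) *
        rieszCap n n (E ∩ dyadicAnnulus n δ (i + 1) p) (dyadicAnnulusO n δ (i + 1) p) < ⊤

/-- A summable series of nonnegative reals stays summable after division by a suitable positive
antitone null sequence. -/
lemma exists_antitone_summable_div {a : ℕ → ℝ} (ha : Summable a) (h0 : ∀ i, 0 ≤ a i) :
    ∃ ε : ℕ → ℝ, (∀ i, 0 < ε i) ∧ Antitone ε ∧ Tendsto ε atTop (𝓝 0) ∧
      Summable (fun i => a i / ε i) := by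
  set b : ℕ → ℝ := fun i => a i + (1 / 2) ^ i with hb
  have hbs : Summable b := ha.add summable_geometric_two
  have hbpos : ∀ i, 0 < b i := fun i => add_pos_of_nonneg_of_pos (h0 i) (by positivity)
  set t : ℕ → ℝ := fun i => ∑' k, b (k + i) with ht
  have hrec : ∀ i, t i = b i + t (i + 1) := by
    intro i
    have := ((summable_nat_add_iff i).2 hbs).tsum_eq_zero_add
    simp only [ht]
    rw [this]
    simp only [zero_add, add_assoc, add_comm 1 i]
  have htpos : ∀ i, 0 < t i := fun i =>
    ((summable_nat_add_iff i).2 hbs).tsum_pos (fun k => (hbpos _).le) 0 (hbpos _)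
  have htanti : Antitone t := antitone_nat_of_succ_le fun i => by
    rw [hrec i]; linarith [hbpos i]
  have hs : ∀ i, 0 < √(t i) := fun i => Real.sqrt_pos.2 (htpos i)
  refine ⟨fun i => √(t i), hs, fun i j hij => Real.sqrt_le_sqrt (htanti hij), ?_, ?_⟩
  · simpa [ht, Function.comp_def] using (Real.continuous_sqrt.tendsto 0).comp (tendsto_sum_nat_add b)
  · have key : ∀ i, a i / √(t i) ≤ 2 * (√(t i) - √(t (i + 1))) := by
      intro i
      rw [div_le_iff₀ (hs i)]
      have h1 := Real.sq_sqrt (htpos i).le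
      have h2 := Real.sq_sqrt (htpos (i + 1)).le
      have h3 : a i ≤ b i := by simp only [hb]; linarith [pow_pos (one_half_pos (α := ℝ)) i]
      nlinarith [hrec i, sq_nonneg (√(t i) - √(t (i + 1)))]
    refine summable_of_sum_range_le (c := 2 * √(t 0)) (fun i => div_nonneg (h0 i) (hs i).le) ?_
    intro N
    calc ∑ i ∈ Finset.range N, a i / √(t i)
        ≤ ∑ i ∈ Finset.range N, 2 * (√(t i) - √(t (i + 1))) :=
          Finset.sum_le_sum fun i _ => key i
      _ = 2 * (√(t 0) - √(t N)) := by rw [← Finset.mul_sum, Finset.sum_range_sub']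
      _ ≤ 2 * √(t 0) := by linarith [hs N]

/-- The Riesz kernel of order `-β` with `0 ≤ β < m` has uniformly bounded integral over the
unit ball of `ℝᵐ`. -/
lemma exists_lintegral_closedBall_rpow_le {m : ℕ} (hm : 1 ≤ m) {β : ℝ} (hβ₀ : 0 ≤ β)
    (hβ : β < m) :
    ∃ C : ℝ≥0∞, C ≠ ⊤ ∧ ∀ z : Euc m,
      ∫⁻ x in closedBall (0 : Euc m) 1, ENNReal.ofReal (‖x - z‖ ^ (-β)) ≤ C := by
  set f : Euc m → ℝ≥0∞ := fun w => ENNReal.ofReal (‖w‖ ^ (-β)) with hf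
  have hfm : Measurable f := by fun_prop
  set g : Euc m → ℝ≥0∞ := (ball (0 : Euc m) 1).indicator f with hg
  have hgm : Measurable g := hfm.indicator measurableSet_ball
  have hint : IntegrableOn (fun w : Euc m => ‖w‖ ^ (-β)) (ball 0 1) := by
    refine integrableOn_ball_of_norm_le_rpow (C := 1) (α := β) (by simpa using hm)
      (by simpa using hβ) ?_ ?_
    · refine Eventually.of_forall fun w => ?_
      rw [one_mul, Real.norm_of_nonneg (by positivity)]
    · exact (by fun_prop : Measurable fun w : Euc m => ‖w‖ ^ (-β)).aestronglyMeasurable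
  have hgfin : ∫⁻ w, g w ≠ ⊤ := by
    rw [hg, lintegral_indicator measurableSet_ball]
    exact hint.lintegral_lt_top.ne
  refine ⟨volume (closedBall (0 : Euc m) 1) + ∫⁻ w, g w,
    ENNReal.add_ne_top.2 ⟨measure_closedBall_lt_top.ne, hgfin⟩, fun z => ?_⟩
  have hle : ∀ w, f w ≤ 1 + g w := by
    intro w
    by_cases hw : w ∈ ball (0 : Euc m) 1
    · simp [hg, hw]
    · have h1 : 1 ≤ ‖w‖ := by simpa using hw
      have : ‖w‖ ^ (-β) ≤ 1 := Real.rpow_le_one_of_one_le_of_nonpos h1 (by linarith)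
      exact (ENNReal.ofReal_le_one.2 this).trans le_self_add
  calc ∫⁻ x in closedBall (0 : Euc m) 1, f (x - z)
      ≤ ∫⁻ x in closedBall (0 : Euc m) 1, (1 + g (x - z)) := lintegral_mono fun x => hle _
    _ = volume (closedBall (0 : Euc m) 1) + ∫⁻ x in closedBall (0 : Euc m) 1, g (x - z) := by
        rw [lintegral_add_left measurable_const]; simp
    _ ≤ volume (closedBall (0 : Euc m) 1) + ∫⁻ x, g (x - z) := by
        gcongr; exact Measure.restrict_le_self
    _ = _ := by rw [lintegral_sub_right_eq_self]

/-- The upper unit hemisphere as a graph over the unit ball: the graph map does not decrease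
distances to the projections. -/
lemma exists_hemisphere_graph (m : ℕ) :
    ∃ (φ : Euc m → Euc (m + 1)) (π : Euc (m + 1) → Euc m), Continuous φ ∧
      (∀ x, ‖x‖ ≤ 1 → ‖φ x‖ = 1) ∧ ∀ x w, ‖x - π w‖ ≤ ‖φ x - w‖ := by
  refine ⟨fun x => WithLp.toLp 2 (Fin.cons (√(1 - ‖x‖ ^ 2)) x.ofLp),
    fun w => WithLp.toLp 2 (fun i => w i.succ), ?_, ?_, ?_⟩
  · refine (PiLp.continuous_toLp 2 _).comp (continuous_pi fun i => ?_)
    refine Fin.cases ?_ (fun j => ?_) i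
    · simp only [Fin.cons_zero]; fun_prop
    · simp only [Fin.cons_succ]; fun_prop
  · intro x hx
    have h : 0 ≤ 1 - ‖x‖ ^ 2 := by nlinarith [norm_nonneg x]
    rw [EuclideanSpace.norm_eq, Fin.sum_univ_succ]
    simp only [Fin.cons_zero, Fin.cons_succ, Real.norm_eq_abs, sq_abs]
    rw [Real.sq_sqrt h, EuclideanSpace.real_norm_sq_eq]
    simp
  · intro x w
    rw [EuclideanSpace.norm_eq, EuclideanSpace.norm_eq]
    refine Real.sqrt_le_sqrt ?_
    rw [Fin.sum_univ_succ (n := m)]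
    simp only [PiLp.sub_apply, Fin.cons_succ]
    exact le_add_of_nonneg_left (by positivity)

lemma rieszPotential_of_lt {n : ℕ} {α : ℝ} (h : α < n) (Ω : Set (Euc n)) (μ : Measure (Euc n))
    (x : Euc n) :
    rieszPotential n α Ω μ x =
      ∫⁻ y in Ω, ENNReal.ofReal (‖x - y‖ ^ (-((n : ℝ) - α))) ∂μ := by
  rw [rieszPotential, if_pos h, neg_sub]

/-- For `α > 1` the capacity of a sphere of radius `r` is at least a constant times
`r ^ (n - α)`. -/
lemma exists_le_rieszCap_sphere {n : ℕ} {α : ℝ} (hα₁ : 1 < α) (hα₂ : α < n) :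
    ∃ c : ℝ≥0∞, c ≠ 0 ∧ c ≠ ⊤ ∧ ∀ (p : Euc n) (r : ℝ) (U : Set (Euc n)), 0 < r →
      c * ENNReal.ofReal (r ^ ((n : ℝ) - α)) ≤ rieszCap n α (sphere p r) U := by
  obtain ⟨m, rfl⟩ : ∃ m, n = m + 1 := by
    refine Nat.exists_eq_succ_of_ne_zero ?_
    rintro rfl
    norm_num at hα₂
    linarith
  have hm : 1 ≤ m := by
    have : (1 : ℝ) < (m + 1 : ℕ) := hα₁.trans hα₂
    rw [Nat.one_lt_cast] at this
    omega
  set β : ℝ := ((m + 1 : ℕ) : ℝ) - α with hβ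
  have hβ₀ : 0 < β := sub_pos.2 hα₂
  have hβm : β < m := by rw [hβ]; push_cast; linarith
  obtain ⟨C, hC, hCle⟩ := exists_lintegral_closedBall_rpow_le hm hβ₀.le hβm
  obtain ⟨φ, π, hφ, hφ1, hφπ⟩ := exists_hemisphere_graph m
  have : Nonempty (Fin m) := ⟨⟨0, hm⟩⟩
  set V := volume (closedBall (0 : Euc m) 1) with hV
  have hV0 : V ≠ 0 := (measure_closedBall_pos volume _ one_pos).ne'
  refine ⟨V / (C + 1), ENNReal.div_ne_zero.2 ⟨hV0, by finiteness⟩,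
    ENNReal.div_ne_top measure_closedBall_lt_top.ne (by simp), fun p r U hr => ?_⟩
  refine le_sInf ?_
  rintro _ ⟨ν, hν, rfl⟩
  by_cases hU : ν U = ⊤
  · rw [hU]; exact le_top
  have : IsFiniteMeasure (ν.restrict U) := isFiniteMeasure_restrict.2 hU
  have hker : ∀ y : Euc (m + 1), ∫⁻ x in closedBall (0 : Euc m) 1,
      ENNReal.ofReal (‖p + r • φ x - y‖ ^ (-β)) ≤ ENNReal.ofReal (r ^ (-β)) * C := by
    intro y
    set z := π (r⁻¹ • (y - p)) with hz
    calc ∫⁻ x in closedBall (0 : Euc m) 1, ENNReal.ofReal (‖p + r • φ x - y‖ ^ (-β))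
        ≤ ∫⁻ x in closedBall (0 : Euc m) 1,
            ENNReal.ofReal (r ^ (-β)) * ENNReal.ofReal (‖x - z‖ ^ (-β)) := by
          refine lintegral_mono_ae (ae_restrict_of_ae ?_)
          filter_upwards [compl_mem_ae_iff.2 (measure_singleton (μ := volume) z)] with x hx
          have hxz : 0 < ‖x - z‖ := norm_pos_iff.2 (sub_ne_zero.2 hx)
          rw [← ENNReal.ofReal_mul (by positivity), ← Real.mul_rpow hr.le hxz.le]
          refine ENNReal.ofReal_le_ofReal
            (Real.rpow_le_rpow_of_nonpos (by positivity) ?_ (by linarith))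
          have he : p + r • φ x - y = r • (φ x - r⁻¹ • (y - p)) := by
            rw [smul_sub, smul_inv_smul₀ hr.ne']; abel
          rw [he, norm_smul, Real.norm_of_nonneg hr.le]
          exact mul_le_mul_of_nonneg_left (hφπ _ _) hr.le
      _ ≤ ENNReal.ofReal (r ^ (-β)) * C := by
          rw [lintegral_const_mul _ (by fun_prop)]
          gcongr
          exact hCle z
  have hmain : V ≤ ENNReal.ofReal (r ^ (-β)) * C * ν U := by
    calc V = ∫⁻ _ in closedBall (0 : Euc m) 1, 1 := by simp [hV]
      _ ≤ ∫⁻ x in closedBall (0 : Euc m) 1, ∫⁻ y in U,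
            ENNReal.ofReal (‖p + r • φ x - y‖ ^ (-β)) ∂ν := by
          refine setLIntegral_mono' measurableSet_closedBall fun x hx => ?_
          have hx1 : ‖φ x‖ = 1 := hφ1 x (by simpa using hx)
          rw [← rieszPotential_of_lt hα₂]
          exact hν _ (by simp [norm_smul, hx1, hr.le])
      _ = ∫⁻ y in U, (∫⁻ x in closedBall (0 : Euc m) 1,
            ENNReal.ofReal (‖p + r • φ x - y‖ ^ (-β))) ∂ν := by
          refine lintegral_lintegral_swap (Measurable.aemeasurable ?_)
          have := hφ.measurable
          unfold Function.uncurry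
          fun_prop
      _ ≤ ∫⁻ _ in U, ENNReal.ofReal (r ^ (-β)) * C ∂ν := lintegral_mono hker
      _ = _ := by simp
  have hr1 : ENNReal.ofReal (r ^ (-β)) * ENNReal.ofReal (r ^ β) = 1 := by
    rw [← ENNReal.ofReal_mul (by positivity), ← Real.rpow_add hr]; simp
  rw [ENNReal.mul_comm_div, ← mul_div_assoc]
  refine ENNReal.div_le_of_le_mul ?_
  calc V * ENNReal.ofReal (r ^ β)
      ≤ ENNReal.ofReal (r ^ (-β)) * C * ν U * ENNReal.ofReal (r ^ β) := by gcongr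
    _ = (ENNReal.ofReal (r ^ (-β)) * ENNReal.ofReal (r ^ β)) * (ν U * C) := by ring
    _ ≤ ν U * (C + 1) := by rw [hr1, one_mul]; gcongr; exact le_self_add

lemma mem_dyadicAnnulus_one {n : ℕ} {i : ℕ} {p x : Euc n} :
    x ∈ dyadicAnnulus n 1 (i + 1) p ↔ ((1 : ℝ) / 2) ^ (i + 1) ≤ ‖x - p‖ ∧
      ‖x - p‖ ≤ ((1 : ℝ) / 2) ^ i := by
  have h1 : (2 : ℝ) ^ (-((i + 1 : ℕ) : ℤ)) * 1 = ((1 : ℝ) / 2) ^ (i + 1) := by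
    rw [zpow_neg, zpow_natCast]; simp
  have h2 : (2 : ℝ) ^ (-((i + 1 : ℕ) : ℤ) + 1) * 1 = ((1 : ℝ) / 2) ^ i := by
    rw [show -((i + 1 : ℕ) : ℤ) + 1 = -(i : ℤ) by push_cast; ring, zpow_neg, zpow_natCast]; simp
  rw [dyadicAnnulus, mem_ofPred_eq, mem_Icc, h1, h2]

lemma mem_dyadicAnnulusO_one {n : ℕ} {i : ℕ} {p x : Euc n} :
    x ∈ dyadicAnnulusO n 1 (i + 1) p ↔ ((1 : ℝ) / 2) ^ (i + 2) < ‖x - p‖ ∧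
      ‖x - p‖ < 2 * ((1 : ℝ) / 2) ^ i := by
  have h1 : (2 : ℝ) ^ (-((i + 1 : ℕ) : ℤ) - 1) * 1 = ((1 : ℝ) / 2) ^ (i + 2) := by
    rw [show -((i + 1 : ℕ) : ℤ) - 1 = -((i + 2 : ℕ) : ℤ) by push_cast; ring, zpow_neg,
      zpow_natCast]; simp
  have h2 : (2 : ℝ) ^ (-((i + 1 : ℕ) : ℤ) + 2) * 1 = 2 * ((1 : ℝ) / 2) ^ i := by
    rw [show -((i + 1 : ℕ) : ℤ) + 2 = -(i : ℤ) + 1 by push_cast; ring,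
      zpow_add₀ (by norm_num), zpow_neg, zpow_natCast]; simp [mul_comm]
  rw [dyadicAnnulusO, mem_ofPred_eq, mem_Ioo, h1, h2]

/-- The open dyadic annuli have bounded overlap, so their masses are summable. -/
lemma summable_measureReal_dyadicAnnulusO {n : ℕ} (ν : Measure (Euc n)) [IsFiniteMeasure ν]
    (p : Euc n) : Summable (fun i : ℕ => ν.real (dyadicAnnulusO n 1 (i + 1) p)) := by
  set b : ℕ → ℝ := fun k => ν.real (ball p (2 * ((1 : ℝ) / 2) ^ k)) with hb
  have hle : ∀ i, ν.real (dyadicAnnulusO n 1 (i + 1) p) ≤ b i - b (i + 3) := by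
    intro i
    have hp : (0 : ℝ) < (1 / 2) ^ i := by positivity
    rw [hb]
    simp only
    rw [← measureReal_sdiff (ball_subset_ball (by rw [pow_add]; nlinarith)) measurableSet_ball]
    refine measureReal_mono fun x hx => ?_
    rw [mem_dyadicAnnulusO_one] at hx
    refine ⟨mem_ball_iff_norm.2 hx.2, fun h => ?_⟩
    rw [mem_ball_iff_norm] at h
    have h1 := hx.1
    rw [pow_add] at h h1
    norm_num at h h1
    linarith
  have hsum : ∀ N, ∑ i ∈ Finset.range N, (b i - b (i + 3)) =
      b 0 + b 1 + b 2 - (b N + b (N + 1) + b (N + 2)) := by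
    intro N
    induction N with
    | zero => simp
    | succ N ih => rw [Finset.sum_range_succ, ih]; ring_nf
  refine summable_of_sum_range_le (c := b 0 + b 1 + b 2) (fun i => measureReal_nonneg) fun N => ?_
  refine (Finset.sum_le_sum fun i _ => hle i).trans ?_
  have : ∀ k, 0 ≤ b k := fun k => measureReal_nonneg
  rw [hsum]
  linarith [this N, this (N + 1), this (N + 2)]

/-- The contribution to the rescaled potential of the points `y` with `‖x - p‖ / 2 ≤ ‖x - y‖`
converges to the mass at `p`. -/
lemma tendsto_rescaled_far_potential {n : ℕ} {β : ℝ} (hβ : 0 < β) (ν : Measure (Euc n))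
    [IsFiniteMeasure ν] (p : Euc n) :
    Tendsto (fun x => ∫⁻ y in (ball x (‖x - p‖ / 2))ᶜ,
        ENNReal.ofReal (‖x - p‖ ^ β) * ENNReal.ofReal (‖x - y‖ ^ (-β)) ∂ν)
      (𝓝[≠] p) (𝓝 (ν {p})) := by
  have hlim : ν {p} = ∫⁻ y, ({p} : Set (Euc n)).indicator 1 y ∂ν := by
    rw [lintegral_indicator_one (measurableSet_singleton p)]
  simp_rw [← lintegral_indicator measurableSet_ball.compl]
  rw [hlim]
  refine tendsto_lintegral_filter_of_dominated_convergence (fun _ => ENNReal.ofReal (2 ^ β))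
    ?_ ?_ ?_ ?_
  · exact Eventually.of_forall fun x =>
      Measurable.indicator (by fun_prop) measurableSet_ball.compl
  · filter_upwards [self_mem_nhdsWithin] with x hx
    have hxp : 0 < ‖x - p‖ := norm_pos_iff.2 (sub_ne_zero.2 hx)
    refine Eventually.of_forall
      (indicator_le (g := fun _ => ENNReal.ofReal (2 ^ β)) fun y hy => ?_)
    have hy' : ‖x - p‖ / 2 ≤ ‖x - y‖ := by
      simpa [mem_ball_iff_norm', -mem_ball] using hy
    rw [← ENNReal.ofReal_mul (by positivity)]
    refine ENNReal.ofReal_le_ofReal ?_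
    have h0 : 0 < ‖x - y‖ := by linarith
    rw [Real.rpow_neg h0.le, ← div_eq_mul_inv, ← Real.div_rpow hxp.le h0.le]
    refine Real.rpow_le_rpow (by positivity) ?_ hβ.le
    rw [div_le_iff₀ h0]
    linarith
  · simp [ENNReal.mul_eq_top]
  · refine Eventually.of_forall fun y => ?_
    by_cases hy : y = p
    · subst hy
      refine tendsto_const_nhds.congr' ?_
      filter_upwards [self_mem_nhdsWithin] with x hx
      have hxp : 0 < ‖x - y‖ := norm_pos_iff.2 (sub_ne_zero.2 hx)
      have hmem : y ∈ (ball x (‖x - y‖ / 2))ᶜ := by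
        simp only [mem_compl_iff, mem_ball_iff_norm, norm_sub_rev y x]
        linarith
      rw [indicator_of_mem hmem, ← ENNReal.ofReal_mul (by positivity), ← Real.rpow_add hxp]
      simp
    · have h1 : Tendsto (fun x : Euc n =>
          ENNReal.ofReal (‖x - p‖ ^ β * ‖x - y‖ ^ (-β))) (𝓝[≠] p) (𝓝 0) := by
        have hc : ContinuousAt (fun x : Euc n => ‖x - p‖ ^ β * ‖x - y‖ ^ (-β)) p := by
          refine ContinuousAt.mul ?_ ?_
          · exact ContinuousAt.rpow_const (by fun_prop) (Or.inr hβ.le)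
          · exact ContinuousAt.rpow_const (by fun_prop)
              (Or.inl (norm_ne_zero_iff.2 (sub_ne_zero.2 (Ne.symm hy))))
        have := (ENNReal.continuous_ofReal.tendsto _).comp
          (hc.tendsto.mono_left (nhdsWithin_le_nhds (s := {p}ᶜ)))
        simpa [Real.zero_rpow hβ.ne', Function.comp_def] using this
      rw [indicator_of_notMem (by simpa using hy)]
      refine tendsto_of_tendsto_of_tendsto_of_le_of_le tendsto_const_nhds h1
        (fun _ => zero_le) fun x => ?_
      refine indicator_le_self' (fun _ _ => zero_le) y |>.trans ?_
      exact (ENNReal.ofReal_mul (by positivity)).ge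

/-- The part of the Riesz kernel potential of `ν` at `x` carried by `ball x (‖x - p‖ / 2)`. -/
def nearPotential (n : ℕ) (β : ℝ) (ν : Measure (Euc n)) (p x : Euc n) : ℝ≥0∞ :=
  ∫⁻ y in ball x (‖x - p‖ / 2), ENNReal.ofReal (‖x - y‖ ^ (-β)) ∂ν

lemma rescaled_potential_eq {n : ℕ} (β : ℝ) (ν : Measure (Euc n)) (p x : Euc n) :
    ENNReal.ofReal (‖x - p‖ ^ β) * ∫⁻ y, ENNReal.ofReal (‖x - y‖ ^ (-β)) ∂ν =
      ENNReal.ofReal (‖x - p‖ ^ β) * nearPotential n β ν p x +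
      ∫⁻ y in (ball x (‖x - p‖ / 2))ᶜ,
        ENNReal.ofReal (‖x - p‖ ^ β) * ENNReal.ofReal (‖x - y‖ ^ (-β)) ∂ν := by
  rw [lintegral_const_mul _ (by fun_prop), nearPotential, ← mul_add,
    lintegral_add_compl _ measurableSet_ball]

lemma ball_subset_dyadicAnnulusO {n i : ℕ} {p x : Euc n} (hx : x ∈ dyadicAnnulus n 1 (i + 1) p) :
    ball x (‖x - p‖ / 2) ⊆ dyadicAnnulusO n 1 (i + 1) p := by
  intro y hy
  rw [mem_ball_iff_norm] at hy
  rw [mem_dyadicAnnulus_one] at hx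
  rw [mem_dyadicAnnulusO_one]
  have h1 : ‖y - p‖ ≤ ‖y - x‖ + ‖x - p‖ := norm_sub_le_norm_sub_add_norm_sub y x p
  have h2 : ‖x - p‖ ≤ ‖x - y‖ + ‖y - p‖ := norm_sub_le_norm_sub_add_norm_sub x y p
  rw [norm_sub_rev x y] at h2
  have hpos : (0 : ℝ) < (1 / 2) ^ i := by positivity
  obtain ⟨h3, h4⟩ := hx
  have h5 : ((1 : ℝ) / 2) ^ (i + 2) = ((1 : ℝ) / 2) ^ (i + 1) / 2 := by ring
  constructor <;> linarith

/-- The points of the unit ball where the rescaled near potential of `ν` exceeds the threshold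
attached to a dyadic annulus containing the point. -/
def exceptionalSet (n : ℕ) (β : ℝ) (ν : Measure (Euc n)) (ε : ℕ → ℝ) (p : Euc n) :
    Set (Euc n) :=
  {x | ∃ j : ℕ, x ∈ dyadicAnnulus n 1 (j + 1) p ∧
    ENNReal.ofReal (ε (j - 1)) < ENNReal.ofReal (‖x - p‖ ^ β) * nearPotential n β ν p x}

lemma rieszCap_exceptionalSet_le {n : ℕ} {α : ℝ} (hα : α < n) (ν : Measure (Euc n))
    [IsFiniteMeasure ν] {ε : ℕ → ℝ} (hε : ∀ i, 0 < ε i) (hanti : Antitone ε) (p : Euc n)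
    (i : ℕ) :
    rieszCap n α (exceptionalSet n ((n : ℝ) - α) ν ε p ∩ dyadicAnnulus n 1 (i + 1) p)
        (dyadicAnnulusO n 1 (i + 1) p) ≤
      ENNReal.ofReal ((((1 : ℝ) / 2) ^ i) ^ ((n : ℝ) - α)) *
        ENNReal.ofReal (ν.real (dyadicAnnulusO n 1 (i + 1) p) / ε i) := by
  set β : ℝ := (n : ℝ) - α with hβ
  have hβ₀ : 0 < β := sub_pos.2 hα
  set s : ℝ := (((1 : ℝ) / 2) ^ i) ^ β with hs
  have hs0 : 0 < s := by positivity
  set O := dyadicAnnulusO n 1 (i + 1) p with hO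
  refine sInf_le ⟨ENNReal.ofReal (s / ε i) • ν, ?_, ?_⟩
  · rintro x ⟨⟨j, hj, hlt⟩, hx⟩
    have hji : j ≤ i + 1 := by
      rw [mem_dyadicAnnulus_one] at hj hx
      exact (pow_le_pow_iff_right_of_lt_one₀ (by norm_num) (by norm_num)).1 (hx.1.trans hj.2)
    have hεi : ε i ≤ ε (j - 1) := hanti (by omega)
    have hxs : ‖x - p‖ ^ β ≤ s :=
      Real.rpow_le_rpow (norm_nonneg _) (mem_dyadicAnnulus_one.1 hx).2 hβ₀.le
    rw [rieszPotential_of_lt hα, Measure.restrict_smul, lintegral_smul_measure, smul_eq_mul]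
    have hεs : ENNReal.ofReal (ε i) ≤ ENNReal.ofReal s *
        ∫⁻ y in O, ENNReal.ofReal (‖x - y‖ ^ (-β)) ∂ν :=
      calc ENNReal.ofReal (ε i) ≤ ENNReal.ofReal (ε (j - 1)) := ENNReal.ofReal_le_ofReal hεi
        _ ≤ _ := hlt.le
        _ ≤ _ := mul_le_mul' (ENNReal.ofReal_le_ofReal hxs)
          (lintegral_mono_set (ball_subset_dyadicAnnulusO hx))
    rw [ENNReal.ofReal_div_of_pos (hε i), ENNReal.mul_comm_div, ← mul_div_assoc,
      ENNReal.le_div_iff_mul_le (by simp [hε i]) (by simp), one_mul]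
    rwa [← hβ]
  · rw [Measure.smul_apply, smul_eq_mul, ← ENNReal.ofReal_mul hs0.le, ← ofReal_measureReal,
      ← ENNReal.ofReal_mul (by have := hε i; positivity)]
    congr 1
    ring

lemma rieszThinAt_exceptionalSet {n : ℕ} {α : ℝ} (hα₁ : 1 < α) (hα₂ : α < n)
    (ν : Measure (Euc n)) [IsFiniteMeasure ν] {ε : ℕ → ℝ} (hε : ∀ i, 0 < ε i)
    (hanti : Antitone ε) (p : Euc n)
    (hsum : Summable fun i => ν.real (dyadicAnnulusO n 1 (i + 1) p) / ε i) :
    RieszThinAt n α (exceptionalSet n ((n : ℝ) - α) ν ε p) p := by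
  rw [RieszThinAt, if_pos hα₂]
  refine ⟨1, one_pos, ?_⟩
  obtain ⟨c, hc0, hct, hc⟩ := exists_le_rieszCap_sphere hα₁ hα₂
  set β : ℝ := (n : ℝ) - α with hβ
  set a : ℕ → ℝ := fun i => ν.real (dyadicAnnulusO n 1 (i + 1) p) / ε i with ha
  have ha0 : ∀ i, 0 ≤ a i := fun i => div_nonneg measureReal_nonneg (hε i).le
  have hfin : ∑' i, ENNReal.ofReal (2 ^ β) / c * ENNReal.ofReal (a i) ≠ ⊤ := by
    rw [ENNReal.tsum_mul_left, ← ENNReal.ofReal_tsum_of_nonneg ha0 hsum]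
    exact ENNReal.mul_ne_top (ENNReal.div_ne_top (by simp) hc0) (by simp)
  refine (ENNReal.tsum_le_tsum fun i => ?_).trans_lt hfin.lt_top
  refine ENNReal.div_le_of_le_mul ((rieszCap_exceptionalSet_le hα₂ ν hε hanti p i).trans ?_)
  have hr : (2 : ℝ) ^ (-(i : ℤ) - 1) * 1 = ((1 : ℝ) / 2) ^ (i + 1) := by
    rw [show -(i : ℤ) - 1 = -((i + 1 : ℕ) : ℤ) by push_cast; ring, zpow_neg, zpow_natCast]; simp
  rw [hr]
  have hcap := hc p (((1 : ℝ) / 2) ^ (i + 1)) (ball p ((2 : ℝ) ^ (-(i : ℤ)) * 1)) (by positivity)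
  have hs : (((1 : ℝ) / 2) ^ i) ^ β = 2 ^ β * (((1 : ℝ) / 2) ^ (i + 1)) ^ β := by
    rw [← Real.mul_rpow (by norm_num) (by positivity)]
    congr 1
    ring
  calc ENNReal.ofReal ((((1 : ℝ) / 2) ^ i) ^ β) * ENNReal.ofReal (a i)
      = ENNReal.ofReal (2 ^ β) / c * ENNReal.ofReal (a i) *
          (c * ENNReal.ofReal ((((1 : ℝ) / 2) ^ (i + 1)) ^ β)) := by
        rw [hs, ENNReal.ofReal_mul (by positivity)]
        nth_rewrite 1 [← ENNReal.div_mul_cancel (b := ENNReal.ofReal (2 ^ β)) hc0 hct]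
        ring
    _ ≤ _ := by gcongr

/-- Off the exceptional set the rescaled near potential vanishes in the limit. -/
lemma tendsto_rescaled_nearPotential {n : ℕ} (β : ℝ) (ν : Measure (Euc n)) {ε : ℕ → ℝ}
    (hanti : Antitone ε) (hlim : Tendsto ε atTop (𝓝 0)) (p : Euc n) :
    Tendsto (fun x => ENNReal.ofReal (‖x - p‖ ^ β) * nearPotential n β ν p x)
      (𝓝[(exceptionalSet n β ν ε p)ᶜ \ {p}] p) (𝓝 0) := by
  rw [ENNReal.tendsto_nhds_zero]
  intro η hη
  have hlim' : Tendsto (fun i => ENNReal.ofReal (ε i)) atTop (𝓝 0) := by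
    simpa [Function.comp_def] using (ENNReal.continuous_ofReal.tendsto 0).comp hlim
  obtain ⟨J, hJ⟩ := ((ENNReal.tendsto_nhds_zero.1 hlim') η hη).exists
  have hball : ball p (((1 : ℝ) / 2) ^ (J + 2)) ∈ 𝓝 p := ball_mem_nhds _ (by positivity)
  filter_upwards [self_mem_nhdsWithin, mem_nhdsWithin_of_mem_nhds hball] with x hx hxb
  have hxp : 0 < ‖x - p‖ := norm_pos_iff.2 (sub_ne_zero.2 hx.2)
  rw [mem_ball_iff_norm] at hxb
  obtain ⟨j, hj1, hj2⟩ := exists_nat_pow_near_of_lt_one hxp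
    (hxb.le.trans (pow_le_one₀ (by norm_num) (by norm_num))) (y := (1 : ℝ) / 2)
    (by norm_num) (by norm_num)
  have hJj : J + 2 < j + 1 :=
    (pow_lt_pow_iff_right_of_lt_one₀ (by norm_num) (by norm_num)).1 (hj1.trans hxb)
  have hnot : ¬ ENNReal.ofReal (ε (j - 1)) <
      ENNReal.ofReal (‖x - p‖ ^ β) * nearPotential n β ν p x :=
    fun h => hx.1 ⟨j, mem_dyadicAnnulus_one.2 ⟨hj1.le, hj2⟩, h⟩
  exact (not_lt.1 hnot).trans
    ((ENNReal.ofReal_le_ofReal (hanti (by omega))).trans hJ)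

/-- if `μ` is a finite nonnegative Radon measure on a bounded domain
`Ω ⊆ ℝⁿ`, `α ∈ (1, n)`, and `p ∈ Ω` satisfies `R^{α,Ω}_μ(p) = ∞`, then there is a
set `A` that is `α`-thin at `p` with
`lim_{x→p, x∉A} |x-p|^{n-α} R^{α,Ω}_μ(x) = μ({p})`. -/
theorem riesz_potential_asymptotics (n : ℕ) (α : ℝ) (hα₁ : 1 < α) (hα₂ : α < n)
    (Ω : Set (Euc n)) (hΩo : IsOpen Ω) (hΩb : Bornology.IsBounded Ω)
    (hΩc : IsConnected Ω)
    (μ : Measure (Euc n)) [IsFiniteMeasure μ]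
    (p : Euc n) (hp : p ∈ Ω) (hinf : rieszPotential n α Ω μ p = ⊤) :
    ∃ A : Set (Euc n), RieszThinAt n α A p ∧
      Tendsto (fun x => ENNReal.ofReal (‖x - p‖ ^ ((n : ℝ) - α)) * rieszPotential n α Ω μ x)
        (𝓝[Aᶜ \ {p}] p) (𝓝 (μ {p})) := by
  obtain ⟨ε, hε, hanti, hlim, hsum⟩ := exists_antitone_summable_div
    (summable_measureReal_dyadicAnnulusO (μ.restrict Ω) p) fun _ => measureReal_nonneg
  refine ⟨exceptionalSet n ((n : ℝ) - α) (μ.restrict Ω) ε p,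
    rieszThinAt_exceptionalSet hα₁ hα₂ _ hε hanti p hsum, ?_⟩
  have hfar := (tendsto_rescaled_far_potential (sub_pos.2 hα₂) (μ.restrict Ω) p).mono_left
    (nhdsWithin_mono p
      (sdiff_subset_compl (exceptionalSet n ((n : ℝ) - α) (μ.restrict Ω) ε p)ᶜ {p}))
  have hadd := (tendsto_rescaled_nearPotential ((n : ℝ) - α) (μ.restrict Ω) hanti hlim p).add hfar
  rw [zero_add, Measure.restrict_apply (measurableSet_singleton p),
    inter_eq_left.2 (singleton_subset_iff.2 hp)] at hadd
  refine hadd.congr fun x => ?_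
  rw [rieszPotential_of_lt hα₂, rescaled_potential_eq]
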